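/- arXiv:1708.03121 — 3 statements merged into one kernel-verified Lean document; each statement's English description precedes it below -/
import Mathlib

section
/- For every finite simple graph G, χ_id(G\R) − t(G) ≤ χ_id(G). Equivalently, χ_id(G\R) ≤ χ_id(G) + t(G): if G admits an identifying coloring with n colors, then its maximal twin-free induced subgraph G\R admits an identifying coloring with at most n + t(G) colors. -/
open SimpleGraph

variable {V : Type*}

/-- The closed neighborhood `N[u]` of a vertex `u`. -/
def closedNbhd (G : SimpleGraph V) (u : V) : Set V := insert u (G.neighborSet u)

/-- Two vertices are twins if they have the same closed neighborhood. -/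
def Twins (G : SimpleGraph V) (u v : V) : Prop := closedNbhd G u = closedNbhd G v

/-- `c` is an identifying coloring of `G`: every pair of non-twin vertices gets
distinct color sets on their closed neighborhoods. -/
def IsIdColoring {α : Type*} (G : SimpleGraph V) (c : V → α) : Prop :=
  ∀ u v : V, ¬ Twins G u v → c '' closedNbhd G u ≠ c '' closedNbhd G v

/-- `χ_id(G)`: the minimum number of colors in an identifying coloring of `G`. -/
noncomputable def chiId (G : SimpleGraph V) : ℕ :=
  sInf {n | ∃ c : V → Fin n, IsIdColoring G c}

/-- `s` is a set of representatives of the twin-equivalence classes of `G`: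
it contains exactly one vertex from each class. The induced subgraph of `G` on
such a set is the maximal twin-free induced subgraph `G\R` (the quotient of `G`
by the twin relation `R`), well-defined up to isomorphism. -/
def IsRepSet (G : SimpleGraph V) (s : Finset V) : Prop :=
  ∀ v : V, ∃! w, w ∈ s ∧ Twins G v w

open Classical in
/-- The twin-equivalence class of a vertex, as a `Finset`. -/
noncomputable def twinClass (G : SimpleGraph V) [Fintype V] (v : V) : Finset V :=
  Finset.univ.filter (Twins G v)

open Classical in
/-- `t(G)`: the number of twin-equivalence classes with at least two vertices. -/
noncomputable def numBigTwinClasses (G : SimpleGraph V) [Fintype V] : ℕ :=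
  ((Finset.univ.image (twinClass G)).filter (fun Q => 2 ≤ Q.card)).card

theorem mem_closedNbhd {G : SimpleGraph V} {u v : V} :
    v ∈ closedNbhd G u ↔ v = u ∨ G.Adj u v := Iff.rfl

theorem mem_closedNbhd_comm {G : SimpleGraph V} {u v : V} :
    v ∈ closedNbhd G u ↔ u ∈ closedNbhd G v := by
  rw [mem_closedNbhd, mem_closedNbhd, eq_comm, G.adj_comm]

theorem mem_closedNbhd_iff_of_twins {G : SimpleGraph V} {u v w : V} (h : Twins G v w) :
    v ∈ closedNbhd G u ↔ w ∈ closedNbhd G u := by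
  rw [mem_closedNbhd_comm, h, mem_closedNbhd_comm]

theorem mem_twinClass [Fintype V] {G : SimpleGraph V} {v w : V} :
    w ∈ twinClass G v ↔ Twins G v w := by
  simp [twinClass]

theorem mem_closedNbhd_induce {G : SimpleGraph V} {s : Set V} {u v : s} :
    v ∈ closedNbhd (G.induce s) u ↔ (v : V) ∈ closedNbhd G u := by
  simp [mem_closedNbhd, Subtype.ext_iff]

theorem Twins.induce {G : SimpleGraph V} {s : Set V} {u v : s} (h : Twins G (u : V) v) :
    Twins (G.induce s) u v := by
  ext w
  rw [mem_closedNbhd_induce, mem_closedNbhd_induce, h]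

theorem Function.Injective.isIdColoring {α : Type*} {G : SimpleGraph V} {c : V → α}
    (hc : Function.Injective c) : IsIdColoring G c :=
  fun _ _ h e => h (hc.image_injective e)

theorem IsIdColoring.comp_injective {α β : Type*} {G : SimpleGraph V} {c : V → α}
    (hc : IsIdColoring G c) {f : α → β} (hf : Function.Injective f) :
    IsIdColoring G (f ∘ c) := by
  intro u v h e
  rw [Set.image_comp, Set.image_comp] at e
  exact hc u v h (hf.image_injective e)

theorem IsIdColoring.chiId_le_card {α : Type*} [Fintype α] {G : SimpleGraph V} {c : V → α}
    (hc : IsIdColoring G c) : chiId G ≤ Fintype.card α :=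
  Nat.sInf_le ⟨_, hc.comp_injective (Fintype.equivFin α).injective⟩

theorem exists_isIdColoring_chiId [Finite V] (G : SimpleGraph V) :
    ∃ c : V → Fin (chiId G), IsIdColoring G c :=
  Nat.sInf_mem (s := {n | ∃ c : V → Fin n, IsIdColoring G c})
    ⟨Nat.card V, Finite.equivFin V, (Finite.equivFin V).injective.isIdColoring⟩

/-- A closed neighborhood is the union of the twin classes of the representatives it contains. -/
theorem IsRepSet.closedNbhd_eq_biUnion [Fintype V] {G : SimpleGraph V} {s : Finset V}
    (hs : IsRepSet G s) (u : (↑s : Set V)) :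
    closedNbhd G (u : V) =
      ⋃ w ∈ closedNbhd (G.induce (↑s : Set V)) u, (twinClass G (w : V) : Set V) := by
  ext x
  simp only [Set.mem_iUnion, Finset.mem_coe, mem_twinClass, mem_closedNbhd_induce, exists_prop]
  constructor
  · intro hx
    obtain ⟨w, ⟨hws, hxw⟩, -⟩ := hs x
    exact ⟨⟨w, hws⟩, (mem_closedNbhd_iff_of_twins hxw).1 hx, hxw.symm⟩
  · rintro ⟨w, hw, hwx⟩
    exact (mem_closedNbhd_iff_of_twins hwx).1 hw

/-- If the image under `c` of every twin class can be recovered from the color given by `c'` to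
its representative, then `c'` is an identifying coloring of the quotient whenever `c` is one of
the graph. -/
theorem IsIdColoring.induce_of_image_twinClass [Fintype V] {α β : Type*} {G : SimpleGraph V}
    {s : Finset V} (hs : IsRepSet G s) {c : V → α} (hc : IsIdColoring G c)
    {c' : (↑s : Set V) → β} {f : β → Set α}
    (hf : ∀ w, f (c' w) = c '' (twinClass G (w : V) : Set V)) :
    IsIdColoring (G.induce (↑s : Set V)) c' := by
  have key (u : (↑s : Set V)) : c '' closedNbhd G (u : V) =
      ⋃ b ∈ c' '' closedNbhd (G.induce (↑s : Set V)) u, f b := by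
    rw [Set.biUnion_image, hs.closedNbhd_eq_biUnion u, Set.image_iUnion₂]
    simp only [hf]
  intro u v huv e
  exact hc u v (fun h => huv h.induce) (by rw [key, key, e])

theorem image_twinClass_of_card_lt_two [Fintype V] {α : Type*} {G : SimpleGraph V} {v : V}
    (h : (twinClass G v).card < 2) (c : V → α) :
    c '' (twinClass G v : Set V) = {c v} := by
  have hv : v ∈ twinClass G v := mem_twinClass.2 rfl
  have : twinClass G v = {v} := Finset.eq_singleton_iff_unique_mem.2
    ⟨hv, fun x hx => Finset.card_le_one.1 (Nat.le_of_lt_succ h) x hx v hv⟩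
  simp [this]

/-- For every finite simple graph `G`, `χ_id(G\R) ≤ χ_id(G) + t(G)`,
i.e. `χ_id(G\R) - t(G) ≤ χ_id(G)`. -/
theorem chiId_quotient_le_chiId_add [Fintype V] (G : SimpleGraph V)
    (s : Finset V) (hs : IsRepSet G s) :
    chiId (G.induce (↑s : Set V)) ≤ chiId G + numBigTwinClasses G := by
  classical
  obtain ⟨c, hc⟩ := exists_isIdColoring_chiId G
  let B := (Finset.univ.image (twinClass G)).filter (fun Q => 2 ≤ Q.card)
  have hB (v : V) (h : 2 ≤ (twinClass G v).card) : twinClass G v ∈ B :=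
    Finset.mem_filter.2 ⟨Finset.mem_image_of_mem _ (Finset.mem_univ v), h⟩
  let c' : (↑s : Set V) → Fin (chiId G) ⊕ B := fun w =>
    if h : 2 ≤ (twinClass G (w : V)).card then Sum.inr ⟨_, hB w h⟩ else Sum.inl (c w)
  let f : Fin (chiId G) ⊕ B → Set (Fin (chiId G)) :=
    Sum.elim (fun a => {a}) (fun Q => c '' (Q.1 : Set V))
  have hf (w) : f (c' w) = c '' (twinClass G (w : V) : Set V) := by
    by_cases h : 2 ≤ (twinClass G (w : V)).card
    · simp [f, c', h]
    · simp [f, c', h, image_twinClass_of_card_lt_two (not_le.1 h)]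
  refine (hc.induce_of_image_twinClass hs hf).chiId_le_card.trans_eq ?_
  rw [Fintype.card_sum, Fintype.card_fin, Fintype.card_coe]
  rfl
end

section
/- Let p ≥ 1 and let c be any lid-coloring of H_p. Then c is injective on the vertex set of H_p; in particular c uses at least 2p + 1 distinct colors. -/
open SimpleGraph

variable {V : Type*}

/-- `c` is a locally identifying (lid-) coloring of `G`: a proper coloring such
that every pair of adjacent non-twin vertices gets distinct color sets on their
closed neighborhoods. -/
def IsLidColoring {α : Type*} (G : SimpleGraph V) (c : V → α) : Prop :=
  (∀ u v : V, G.Adj u v → c u ≠ c v) ∧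
  ∀ u v : V, G.Adj u v → ¬ Twins G u v → c '' closedNbhd G u ≠ c '' closedNbhd G v

/-- The split graph `H_p`: `Sum.inl i` is the independent vertex `s_{i+1}`
(for `i : Fin p`, representing `s_1, …, s_p`) and `Sum.inr j` is the clique
vertex `k_j` (for `j : Fin (p+1)`, representing `k_0, …, k_p`); besides the
clique edges, the only other edges are `s_{i+1} k_{i+1}` for `i = 0, …, p-1`. -/
def Hp (p : ℕ) : SimpleGraph (Fin p ⊕ Fin (p + 1)) :=
  SimpleGraph.fromRel (fun a b =>
    match a, b with
    | Sum.inr _, Sum.inr _ => True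
    | Sum.inl i, Sum.inr j => (j : ℕ) = (i : ℕ) + 1
    | _, _ => False)

theorem Hp_adj_inr_inr {p : ℕ} {i j : Fin (p + 1)} :
    (Hp p).Adj (Sum.inr i) (Sum.inr j) ↔ i ≠ j := by
  simp [Hp]

theorem Hp_adj_inr_inl {p : ℕ} {j : Fin (p + 1)} {i : Fin p} :
    (Hp p).Adj (Sum.inr j) (Sum.inl i) ↔ j = i.succ := by
  simp [Hp, Fin.ext_iff]

theorem closedNbhd_Hp_inr_zero (p : ℕ) :
    closedNbhd (Hp p) (Sum.inr 0) = Set.range Sum.inr := by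
  ext (i | j)
  · simpa [closedNbhd, Hp_adj_inr_inl] using (Fin.succ_ne_zero i).symm
  · simpa [closedNbhd, Hp_adj_inr_inr, eq_comm] using em (j = 0)

theorem closedNbhd_Hp_inr_succ {p : ℕ} (i : Fin p) :
    closedNbhd (Hp p) (Sum.inr i.succ) = insert (Sum.inl i) (Set.range Sum.inr) := by
  ext (j | j)
  · simp [closedNbhd, Hp_adj_inr_inl, eq_comm]
  · simpa [closedNbhd, Hp_adj_inr_inr, eq_comm] using em (j = i.succ)

/-- Adjacent vertices whose closed neighborhoods have the same color set are twins. -/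
theorem IsLidColoring.closedNbhd_eq_of_image_eq {α : Type*} {G : SimpleGraph V} {c : V → α}
    (hc : IsLidColoring G c) {u v : V} (huv : G.Adj u v)
    (h : c '' closedNbhd G u = c '' closedNbhd G v) : closedNbhd G u = closedNbhd G v :=
  by_contra fun hne => hc.2 u v huv hne h

theorem IsLidColoring.inl_ne_inr {α : Type*} {p : ℕ} {c : Fin p ⊕ Fin (p + 1) → α}
    (hc : IsLidColoring (Hp p) c) (i : Fin p) (j : Fin (p + 1)) :
    c (Sum.inl i) ≠ c (Sum.inr j) := by
  intro h
  have key := hc.closedNbhd_eq_of_image_eq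
    (Hp_adj_inr_inr.2 (Fin.succ_ne_zero i)) (by
      rw [closedNbhd_Hp_inr_succ, closedNbhd_Hp_inr_zero, Set.image_insert_eq, h]
      exact Set.insert_eq_of_mem (Set.mem_image_of_mem c (Set.mem_range_self j)))
  rw [closedNbhd_Hp_inr_succ, closedNbhd_Hp_inr_zero] at key
  simpa using key.subset (Set.mem_insert _ _)

theorem IsLidColoring.inl_injective {α : Type*} {p : ℕ} {c : Fin p ⊕ Fin (p + 1) → α}
    (hc : IsLidColoring (Hp p) c) : Function.Injective (c ∘ Sum.inl) := by
  intro i j h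
  by_contra hij
  have key := hc.closedNbhd_eq_of_image_eq
    (Hp_adj_inr_inr.2 ((Fin.succ_injective p).ne hij)) (by
      rw [closedNbhd_Hp_inr_succ, closedNbhd_Hp_inr_succ, Set.image_insert_eq,
        Set.image_insert_eq]
      exact congrArg (insert · _) h)
  rw [closedNbhd_Hp_inr_succ, closedNbhd_Hp_inr_succ] at key
  exact hij (by simpa using key.subset (Set.mem_insert _ _))

theorem IsLidColoring.inr_injective {α : Type*} {p : ℕ} {c : Fin p ⊕ Fin (p + 1) → α}
    (hc : IsLidColoring (Hp p) c) : Function.Injective (c ∘ Sum.inr) :=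
  fun _ _ h => by_contra fun hij => hc.1 _ _ (Hp_adj_inr_inr.2 hij) h

/-- Any lid-coloring of `H_p` (`p ≥ 1`) is injective on the vertex set;
in particular it uses at least `2p + 1` distinct colors. -/
theorem lidColoring_Hp_injective (p : ℕ) (hp : 1 ≤ p)
    (c : Fin p ⊕ Fin (p + 1) → ℕ) (hc : IsLidColoring (Hp p) c) :
    Function.Injective c ∧ 2 * p + 1 ≤ (Finset.univ.image c).card := by
  have hinj : Function.Injective c := by
    rintro (i | i) (j | j) h
    · exact congrArg Sum.inl (hc.inl_injective h)
    · exact absurd h (hc.inl_ne_inr i j)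
    · exact absurd h.symm (hc.inl_ne_inr j i)
    · exact congrArg Sum.inr (hc.inr_injective h)
  refine ⟨hinj, ?_⟩
  rw [Finset.card_image_of_injective _ hinj, Finset.card_univ, Fintype.card_sum,
    Fintype.card_fin, Fintype.card_fin]
  lia
end

section
/- For every integer a ≥ 1, χ_id(H^{ext}_{2^a}) = a + 2. -/
open SimpleGraph

variable {V : Type*}

/-- The graph `H^{ext}_{2^a}`: `Sum.inl E` is the clique vertex `k_E` (for
`E ⊆ {1, …, a}`, encoded as `E : Finset (Fin a)`) and `Sum.inr ⟨(E, i), _⟩`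
(with `i ∈ E`) is the vertex `s_{E,i}`; besides the clique edges on the `k_E`,
the other edges are `s_{E,i} k_E` for `i ∈ E` and `s_{E,i} s_{E,j}` for
`i, j ∈ E`, `i ≠ j`. -/
def Hext (a : ℕ) :
    SimpleGraph (Finset (Fin a) ⊕ {q : Finset (Fin a) × Fin a // q.2 ∈ q.1}) :=
  SimpleGraph.fromRel (fun x y =>
    match x, y with
    | Sum.inl _, Sum.inl _ => True
    | Sum.inl E, Sum.inr s => s.1.1 = E
    | Sum.inr s, Sum.inl E => s.1.1 = E
    | Sum.inr s, Sum.inr t => s.1.1 = t.1.1)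

/-- The vertex set of `Hext a`. -/
abbrev HextVertex (a : ℕ) : Type :=
  Finset (Fin a) ⊕ {q : Finset (Fin a) × Fin a // q.2 ∈ q.1}

theorem closedNbhd_Hext_inl {a : ℕ} (E : Finset (Fin a)) :
    closedNbhd (Hext a) (Sum.inl E) = {x | Sum.elim (fun _ => True) (fun s => s.1.1 = E) x} := by
  ext x
  rcases x with F | s
  · by_cases h : E = F <;> simp [closedNbhd, Hext, h, Ne.symm]
  · simp [closedNbhd, Hext]

theorem closedNbhd_Hext_inr {a : ℕ} (s : {q : Finset (Fin a) × Fin a // q.2 ∈ q.1}) :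
    closedNbhd (Hext a) (Sum.inr s) =
      {x | Sum.elim id (fun t => t.1.1) x = s.1.1} := by
  ext x
  rcases x with F | t
  · simp [closedNbhd, Hext, eq_comm]
  · by_cases h : t = s
    · simp [closedNbhd, h]
    · simp [closedNbhd, Hext, Ne.symm h, eq_comm]

theorem not_twins_Hext_inl {a : ℕ} {E F : Finset (Fin a)} (h : E ≠ F) :
    ¬ Twins (Hext a) (Sum.inl E) (Sum.inl F) := by
  intro ht
  unfold Twins at ht
  rw [closedNbhd_Hext_inl, closedNbhd_Hext_inl, Set.ext_iff] at ht
  have key : ∀ i, i ∉ E ∧ i ∉ F := fun i =>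
    ⟨fun hi => h (by simpa using ht (Sum.inr ⟨(E, i), hi⟩)),
      fun hi => h (by simpa [eq_comm] using ht (Sum.inr ⟨(F, i), hi⟩))⟩
  exact h (Finset.ext fun i => iff_of_false (key i).1 (key i).2)

/-- An identifying coloring of `Hext a` with at most `a + 1` colors is constant on the clique. -/
theorem IsIdColoring.const_on_clique {a n : ℕ} {c : HextVertex a → Fin n}
    (hc : IsIdColoring (Hext a) c) (hn : n ≤ a + 1) (E F : Finset (Fin a)) :
    c (Sum.inl E) = c (Sum.inl F) := by
  classical
  by_contra hne
  set P : Finset (Fin n) := {c (Sum.inl E), c (Sum.inl F)} with hP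
  have hPsub : ∀ D x, x ∈ P → x ∈ c '' closedNbhd (Hext a) (Sum.inl D) := by
    intro D x hx
    rw [closedNbhd_Hext_inl]
    rcases (by simpa [hP] using hx : x = _ ∨ x = _) with rfl | rfl
    exacts [⟨Sum.inl E, by simp, rfl⟩, ⟨Sum.inl F, by simp, rfl⟩]
  have hcard : (Finset.univ : Finset (Finset (Fin a))).card ≤ (Pᶜ).powerset.card := by
    refine Finset.card_le_card_of_injOn
      (fun D => Pᶜ.filter (· ∈ c '' closedNbhd (Hext a) (Sum.inl D)))
      (fun D _ => Finset.mem_powerset.2 (Finset.filter_subset _ _)) ?_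
    intro D _ D' _ hDD'
    by_contra hD
    refine hc _ _ (not_twins_Hext_inl hD) (Set.ext fun x => ?_)
    by_cases hx : x ∈ P
    · exact iff_of_true (hPsub D x hx) (hPsub D' x hx)
    · simpa only [Finset.mem_filter, Finset.mem_compl, hx, not_false_eq_true, true_and]
        using Finset.ext_iff.1 hDD' x
  have hP2 : P.card = 2 := Finset.card_pair hne
  rw [Finset.card_powerset, Finset.card_compl, hP2, Finset.card_univ, Fintype.card_finset,
    Fintype.card_fin, Fintype.card_fin, Nat.pow_le_pow_iff_right (by norm_num)] at hcard
  have := P.card_le_univ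
  rw [hP2, Fintype.card_fin] at this
  omega

theorem IsIdColoring.add_two_le {a n : ℕ} (ha : 1 ≤ a) {c : HextVertex a → Fin n}
    (hc : IsIdColoring (Hext a) c) : a + 2 ≤ n := by
  by_contra! hlt
  have hconst := hc.const_on_clique (by omega)
  let s : {q : Finset (Fin a) × Fin a // q.2 ∈ q.1} :=
    ⟨(Finset.univ, ⟨0, ha⟩), Finset.mem_univ _⟩
  have huniv : (∅ : Finset (Fin a)) ≠ Finset.univ :=
    fun h => Finset.notMem_empty (⟨0, ha⟩ : Fin a) (h ▸ Finset.mem_univ _)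
  refine hc (Sum.inl Finset.univ) (Sum.inr s) ?_ ?_
  · unfold Twins
    rw [closedNbhd_Hext_inl, closedNbhd_Hext_inr, Set.ext_iff]
    intro h
    exact huniv (by simpa [s] using h (Sum.inl ∅))
  · rw [closedNbhd_Hext_inl, closedNbhd_Hext_inr]
    ext x
    constructor
    · rintro ⟨F | t, hF, rfl⟩
      · exact ⟨Sum.inl Finset.univ, by simp [s], hconst _ _⟩
      · exact ⟨Sum.inr t, by simpa [s] using hF, rfl⟩
    · rintro ⟨F | t, hF, rfl⟩
      · exact ⟨Sum.inl F, by simp, rfl⟩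
      · exact ⟨Sum.inr t, by simpa [s] using hF, rfl⟩

/-- The coloring of `Hext a` giving `s_{E,i}` the color `i + 2`, the vertex `k_∅` the color `0`
and all other clique vertices the color `1`. -/
def hextColoring (a : ℕ) : HextVertex a → Fin (a + 2) :=
  Sum.elim (fun E => if E = ∅ then 0 else 1) (fun s => s.1.2.succ.succ)

theorem succ_succ_mem_hextColoring_image {a : ℕ} (v : HextVertex a) (i : Fin a) :
    i.succ.succ ∈ hextColoring a '' closedNbhd (Hext a) v ↔
      i ∈ Sum.elim id (fun s => s.1.1) v := by
  have hK : ∀ F : Finset (Fin a), hextColoring a (Sum.inl F) ≠ i.succ.succ := by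
    intro F
    by_cases hF : F = ∅ <;> simp [hextColoring, hF, Fin.ext_iff]
  rcases v with E | s
  · rw [closedNbhd_Hext_inl]
    constructor
    · rintro ⟨F | ⟨⟨F, j⟩, hj⟩, hF, h⟩
      · exact absurd h (hK F)
      · obtain rfl : F = E := by simpa using hF
        obtain rfl : j = i := by simpa [hextColoring] using h
        exact hj
    · intro hi
      exact ⟨Sum.inr ⟨(E, i), hi⟩, by simp, rfl⟩
  · rw [closedNbhd_Hext_inr]
    constructor
    · rintro ⟨F | ⟨⟨F, j⟩, hj⟩, hF, h⟩
      · exact absurd h (hK F)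
      · obtain rfl : F = s.1.1 := by simpa using hF
        obtain rfl : j = i := by simpa [hextColoring] using h
        exact hj
    · intro hi
      exact ⟨Sum.inr ⟨(s.1.1, i), hi⟩, by simp, rfl⟩

theorem zero_mem_hextColoring_image_inl {a : ℕ} (E : Finset (Fin a)) :
    0 ∈ hextColoring a '' closedNbhd (Hext a) (Sum.inl E) := by
  rw [closedNbhd_Hext_inl]
  exact ⟨Sum.inl ∅, by simp, by simp [hextColoring]⟩

theorem zero_notMem_hextColoring_image_inr {a : ℕ}
    (s : {q : Finset (Fin a) × Fin a // q.2 ∈ q.1}) :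
    0 ∉ hextColoring a '' closedNbhd (Hext a) (Sum.inr s) := by
  rw [closedNbhd_Hext_inr]
  rintro ⟨F | t, hF, h⟩
  · obtain rfl : F = s.1.1 := by simpa using hF
    simp [hextColoring, Finset.ne_empty_of_mem s.2] at h
  · simp [hextColoring] at h

theorem isIdColoring_hextColoring (a : ℕ) : IsIdColoring (Hext a) (hextColoring a) := by
  intro u v huv h
  have hidx : Sum.elim id (fun s => s.1.1) u = Sum.elim id (fun s => s.1.1) v := by
    ext i
    rw [← succ_succ_mem_hextColoring_image u, h, succ_succ_mem_hextColoring_image v]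
  rcases u with E | s <;> rcases v with F | t
  · exact huv (congrArg (fun D => closedNbhd (Hext a) (Sum.inl D)) hidx)
  · exact zero_notMem_hextColoring_image_inr t (h ▸ zero_mem_hextColoring_image_inl E)
  · exact zero_notMem_hextColoring_image_inr s (h ▸ zero_mem_hextColoring_image_inl F)
  · refine huv ?_
    unfold Twins
    rw [closedNbhd_Hext_inr, closedNbhd_Hext_inr]
    simp only [Sum.elim_inr] at hidx
    rw [hidx]

/-- For every integer `a ≥ 1`, `χ_id(H^{ext}_{2^a}) = a + 2`. -/
theorem chiId_Hext (a : ℕ) (ha : 1 ≤ a) : chiId (Hext a) = a + 2 := by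
  refine IsLeast.csInf_eq ⟨⟨hextColoring a, isIdColoring_hextColoring a⟩, ?_⟩
  rintro n ⟨c, hc⟩
  exact hc.add_two_le ha
end
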